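/- For every real ν > 0, every n ∈ ℕ, and every real t > 0, the Laguerre functions ℓ_n^ν(t) = e^{−t} L_n^{ν−1}(2t) satisfy the raising relation t · (ℓ_n^ν)''(t) − (2t − ν) · (ℓ_n^ν)'(t) + (t − ν) · ℓ_n^ν(t) = −2(n + 1) · ℓ_{n+1}^ν(t). -/

import Mathlib

/-- The Laguerre polynomial `L_n^α(x) = ∑_{k=0}^n Γ(n+α+1)/Γ(k+α+1) · (−x)^k/(k!(n−k)!)`. -/
noncomputable def laguerreL (α : ℝ) (n : ℕ) (x : ℝ) : ℝ :=
  ∑ k ∈ Finset.range (n + 1),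
    Real.Gamma (n + α + 1) / Real.Gamma (k + α + 1) * (-x) ^ k /
      (Nat.factorial k * Nat.factorial (n - k))

/-- The Laguerre function with parameter `ν`: `ℓ_n^ν(t) = e^{−t} L_n^{ν−1}(2t)`. -/
noncomputable def laguerreEll (ν : ℝ) (n : ℕ) (t : ℝ) : ℝ :=
  Real.exp (-t) * laguerreL (ν - 1) n (2 * t)

open Polynomial in
/-- The Laguerre polynomial `L_n^{ν-1}` as an element of `ℝ[X]`. -/
noncomputable def laguerrePoly (ν : ℝ) (n : ℕ) : ℝ[X] :=
  ∑ k ∈ Finset.range (n + 1),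
    monomial k (Real.Gamma (n + ν) / Real.Gamma (k + ν) * (-1) ^ k /
      (Nat.factorial k * Nat.factorial (n - k)))

namespace laguerrePoly

open Polynomial

theorem eval_eq (ν : ℝ) (n : ℕ) (x : ℝ) :
    (laguerrePoly ν n).eval x = laguerreL (ν - 1) n x := by
  simp only [laguerrePoly, laguerreL, eval_finsetSum, eval_monomial]
  refine Finset.sum_congr rfl fun k _ => ?_
  rw [neg_pow x, show (n : ℝ) + (ν - 1) + 1 = n + ν by ring,
    show (k : ℝ) + (ν - 1) + 1 = k + ν by ring]
  ring

theorem coeff_of_le (ν : ℝ) {n k : ℕ} (h : k ≤ n) :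
    (laguerrePoly ν n).coeff k = Real.Gamma (n + ν) / Real.Gamma (k + ν) * (-1) ^ k /
      (Nat.factorial k * Nat.factorial (n - k)) := by
  simp [laguerrePoly, finsetSum_coeff, coeff_monomial, Nat.lt_succ_of_le h]

theorem coeff_of_lt (ν : ℝ) {n k : ℕ} (h : n < k) : (laguerrePoly ν n).coeff k = 0 := by
  simp only [laguerrePoly, finsetSum_coeff, coeff_monomial]
  exact Finset.sum_eq_zero fun j hj => if_neg (by have := Finset.mem_range.1 hj; omega)

theorem coeff_succ {ν : ℝ} (hν : 0 < ν) (n k : ℕ) :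
    (k + 1) * (k + ν) * (laguerrePoly ν n).coeff (k + 1) =
      (k - n) * (laguerrePoly ν n).coeff k := by
  rcases lt_trichotomy k n with h | rfl | h
  · obtain ⟨m, rfl⟩ := Nat.exists_eq_add_of_lt h
    have hk : (0 : ℝ) < k + ν := by positivity
    have hG := Real.Gamma_pos_of_pos hk
    rw [coeff_of_le ν (k := k + 1) h, coeff_of_le ν h.le, show k + m + 1 - (k + 1) = m by omega,
      show k + m + 1 - k = m + 1 by omega]
    push_cast [Nat.factorial_succ, pow_succ]
    rw [show (k : ℝ) + 1 + ν = k + ν + 1 by ring, Real.Gamma_add_one hk.ne']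
    field_simp
    ring
  · simp [coeff_of_lt ν (Nat.lt_succ_self k)]
  · simp [coeff_of_lt ν h, coeff_of_lt ν (Nat.lt_succ_of_lt h)]

theorem coeff_succ_succ {ν : ℝ} (hν : 0 < ν) (n k : ℕ) :
    (k + 1) * (k + ν) * (laguerrePoly ν (n + 1)).coeff (k + 1) =
      -(n + ν) * (laguerrePoly ν n).coeff k := by
  rcases le_or_gt k n with h | h
  · have hk : (0 : ℝ) < k + ν := by positivity
    have hn : (0 : ℝ) < n + ν := by positivity
    have hG := Real.Gamma_pos_of_pos hk
    rw [coeff_of_le ν h, coeff_of_le ν (Nat.add_le_add_right h 1), Nat.add_sub_add_right]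
    push_cast [Nat.factorial_succ, pow_succ]
    rw [show (k : ℝ) + 1 + ν = k + ν + 1 by ring, show (n : ℝ) + 1 + ν = n + ν + 1 by ring,
      Real.Gamma_add_one hk.ne', Real.Gamma_add_one hn.ne']
    field_simp
  · simp [coeff_of_lt ν h, coeff_of_lt ν (Nat.succ_lt_succ h)]

theorem succ_coeff_zero {ν : ℝ} (hν : 0 < ν) (n : ℕ) :
    (n + 1) * (laguerrePoly ν (n + 1)).coeff 0 = (n + ν) * (laguerrePoly ν n).coeff 0 := by
  have hn : (0 : ℝ) < n + ν := by positivity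
  have hG := Real.Gamma_pos_of_pos hν
  rw [coeff_of_le ν n.zero_le, coeff_of_le ν (n + 1).zero_le]
  push_cast [Nat.factorial_succ, Nat.sub_zero]
  rw [show (n : ℝ) + 1 + ν = n + ν + 1 by ring, Real.Gamma_add_one hn.ne']
  field_simp

theorem raising {ν : ℝ} (hν : 0 < ν) (n : ℕ) :
    X * derivative (derivative (laguerrePoly ν n)) + C ν * derivative (laguerrePoly ν n) -
      C 2 * (X * derivative (laguerrePoly ν n)) + X * laguerrePoly ν n - C ν * laguerrePoly ν n =
      C (-(n + 1 : ℝ)) * laguerrePoly ν (n + 1) := by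
  ext k
  rcases k with _ | k
  · have h₁ := coeff_succ hν n 0
    have h₂ := succ_coeff_zero hν n
    simp [coeff_derivative] at h₁ ⊢
    linarith
  · have h₁ := coeff_succ hν n (k + 1)
    have h₂ := coeff_succ hν n k
    have h₃ := coeff_succ_succ hν n k
    have hk : ((k : ℝ) + 1) * (k + ν) ≠ 0 := by positivity
    apply mul_left_cancel₀ hk
    simp only [coeff_add, coeff_sub, coeff_C_mul, coeff_X_mul, coeff_derivative]
    push_cast at h₁ ⊢
    linear_combination (k + 1) * (k + ν) * h₁ - (n + k + 1 + ν) * h₂ + (n + 1) * h₃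

end laguerrePoly

theorem hasDerivAt_exp_neg_mul_eval (p : Polynomial ℝ) (t : ℝ) :
    HasDerivAt (fun s => Real.exp (-s) * p.eval (2 * s))
      (Real.exp (-t) * (Polynomial.C 2 * p.derivative - p).eval (2 * t)) t := by
  have h₁ : HasDerivAt (fun s : ℝ => Real.exp (-s)) (Real.exp (-t) * -1) t :=
    (hasDerivAt_neg t).exp
  have h₂ : HasDerivAt (fun s : ℝ => p.eval (2 * s)) (p.derivative.eval (2 * t) * (2 * 1)) t :=
    (p.hasDerivAt (2 * t)).comp t ((hasDerivAt_id t).const_mul 2)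
  refine (h₁.mul h₂).congr_deriv ?_
  simp only [Polynomial.eval_sub, Polynomial.eval_mul, Polynomial.eval_C]
  ring

theorem laguerreEll_raising {ν : ℝ} (hν : 0 < ν) (n : ℕ) (t : ℝ) :
    t * deriv (deriv (laguerreEll ν n)) t - (2 * t - ν) * deriv (laguerreEll ν n) t +
      (t - ν) * laguerreEll ν n t = -2 * (n + 1) * laguerreEll ν (n + 1) t := by
  have hE (m : ℕ) : laguerreEll ν m =
      fun s => Real.exp (-s) * (laguerrePoly ν m).eval (2 * s) := by
    funext s
    rw [laguerreEll, laguerrePoly.eval_eq]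
  have hd (p : Polynomial ℝ) : deriv (fun s => Real.exp (-s) * p.eval (2 * s)) =
      fun s => Real.exp (-s) * (Polynomial.C 2 * p.derivative - p).eval (2 * s) :=
    funext fun s => (hasDerivAt_exp_neg_mul_eval p s).deriv
  have h := congrArg (Polynomial.eval (2 * t)) (laguerrePoly.raising hν n)
  simp only [hE, hd]
  simp only [Polynomial.derivative_sub, Polynomial.derivative_C_mul, Polynomial.eval_add,
    Polynomial.eval_sub, Polynomial.eval_mul, Polynomial.eval_C, Polynomial.eval_X] at h ⊢
  linear_combination 2 * Real.exp (-t) * h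

theorem laguerreEll_lowering (ν : ℝ) (hν : 0 < ν) (n : ℕ) (hn : 1 ≤ n) (t : ℝ) (ht : 0 < t) :
    t * deriv (deriv (laguerreEll ν n)) t - (2 * t - ν) * deriv (laguerreEll ν n) t +
      (t - ν) * laguerreEll ν n t = -2 * (n + 1) * laguerreEll ν (n + 1) t := by
  exact laguerreEll_raising hν n t
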